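/- Let G be a 5-critical graph (χ(G) = 5 and χ(G − v) = 4 for every vertex v) on n vertices, and suppose S ⊆ V(G) is an independent set of size 4 such that G − S is connected and has chromatic number 4. Then for every integer y ≥ 4, Q_G(y) ≤ (y+1)·y^{n-4}·(y-1)·(y-2)·(y-3). -/

import Mathlib

/-- The number of proper colourings of `G` with `x` (labelled) colours. -/
noncomputable def numColorings {V : Type} (G : SimpleGraph V) (x : ℕ) : ℕ :=
  Nat.card {f : V → Fin x // ∀ u v : V, G.Adj u v → f u ≠ f v}

/-- `G` is `5`-critical: `χ(G) = 5` and deleting any single vertex yields a graph of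
chromatic number `4`. -/
def FiveCritical {V : Type} (G : SimpleGraph V) : Prop :=
  G.chromaticNumber = 5 ∧ ∀ v : V, (G.induce {u : V | u ≠ v}).chromaticNumber = 4

open Classical in
/-- The finset of proper colourings of `G` with colours in `Fin x`. -/
noncomputable def properColorings {V : Type} [Fintype V] (G : SimpleGraph V) (x : ℕ) :
    Finset (V → Fin x) :=
  Finset.univ.filter fun f => ∀ u v : V, G.Adj u v → f u ≠ f v

lemma mem_properColorings {V : Type} [Fintype V] {G : SimpleGraph V} {x : ℕ} {f : V → Fin x} :
    f ∈ properColorings G x ↔ ∀ u v : V, G.Adj u v → f u ≠ f v := by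
  simp [properColorings]

lemma numColorings_eq_card {V : Type} [Fintype V] (G : SimpleGraph V) (x : ℕ) :
    numColorings G x = (properColorings G x).card := by
  classical
  rw [numColorings, Nat.card_eq_fintype_card, Fintype.card_subtype]
  rfl

open Classical in
/-- Counting colourings by first colouring the induced subgraph on `T = V \ S` and then extending
to `S`: the vertex `s` has to avoid the colours seen on the set `N s` of neighbours. -/
lemma numColorings_le_sum_prod {V : Type} [Fintype V] (G : SimpleGraph V) (x : ℕ)
    (S : Finset V) (T : Set V) [Fintype T] (hT : ∀ v, v ∈ T ↔ v ∉ S) (N : V → Finset T)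
    (hN : ∀ s ∈ S, ∀ u ∈ N s, G.Adj s u) :
    numColorings G x ≤ ∑ f ∈ properColorings (G.induce T) x,
      ∏ s ∈ S, (x - ((N s).image f).card) := by
  have hmap : ∀ F ∈ properColorings G x,
      (fun u : T => F u) ∈ properColorings (G.induce T) x := by
    intro F hF
    rw [mem_properColorings] at hF ⊢
    intro u v huv
    exact hF _ _ huv
  rw [numColorings_eq_card, Finset.card_eq_sum_card_fiberwise hmap]
  refine Finset.sum_le_sum fun f _ => ?_
  have hcard : (S.pi fun s => ((N s).image f)ᶜ).card =
      ∏ s ∈ S, (x - ((N s).image f).card) := by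
    rw [Finset.card_pi]
    refine Finset.prod_congr rfl fun s _ => ?_
    rw [Finset.card_compl, Fintype.card_fin]
  rw [← hcard]
  refine Finset.card_le_card_of_injOn (fun F s _ => F s) ?_ ?_
  · intro F hF
    simp only [Finset.coe_filter, Set.mem_ofPred_eq, mem_properColorings] at hF
    simp only [Finset.mem_coe, Finset.mem_pi, Finset.mem_compl, Finset.mem_image, not_exists,
      not_and]
    intro s hs u hu heq
    rw [← hF.2] at heq
    exact hF.1 _ _ (hN s hs u hu) heq.symm
  · intro F hF F' hF' h
    simp only [Finset.coe_filter, Set.mem_ofPred_eq] at hF hF'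
    funext v
    by_cases hv : v ∈ S
    · exact congrFun (congrFun h v) hv
    · exact congrFun (hF.2.trans hF'.2.symm) ⟨v, (hT v).2 hv⟩

open Classical in
lemma numColorings_le_sum {V : Type} [Fintype V] (G : SimpleGraph V) (x : ℕ) (v : V)
    (N : Finset ({v}ᶜ : Set V)) (hN : ∀ u ∈ N, G.Adj v u) :
    (numColorings G x : ℝ) ≤ ∑ f ∈ properColorings (G.induce {v}ᶜ) x,
      ((x - (N.image f).card : ℕ) : ℝ) := by
  have h := numColorings_le_sum_prod G x {v} {v}ᶜ (by simp) (fun _ => N)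
    (by simpa using hN)
  simp only [Finset.prod_singleton] at h
  exact_mod_cast h

/-- The colourings of `G` that are constant on the fibres of `p` number at most those of a connected
graph on the range of `p`, all of whose colourings pull back to `G`, unless there are none. -/
lemma exists_connected_identification {V : Type} [Fintype V] {G : SimpleGraph V}
    (hG : G.Connected) {x : ℕ} (p : V → V) (P : (V → Fin x) → Prop) [DecidablePred P]
    (hP : ∀ f, P f → ∀ v, f (p v) = f v) :
    (∀ f ∈ properColorings G x, ¬ P f) ∨ ∃ H : SimpleGraph (Set.range p), H.Connected ∧
      ((properColorings G x).filter P).card ≤ numColorings H x ∧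
      ∀ k, H.Colorable k → ∃ c : G.Coloring (Fin k), ∀ a b, p a = p b → c a = c b := by
  classical
  by_cases hloop : ∃ a b, G.Adj a b ∧ p a = p b
  · left
    obtain ⟨a, b, hab, hp⟩ := hloop
    intro f hf hPf
    rw [mem_properColorings] at hf
    exact hf a b hab (by rw [← hP f hPf a, hp, hP f hPf b])
  right
  push Not at hloop
  let q : V → Set.range p := fun v => ⟨p v, v, rfl⟩
  have hq : ∀ a b, q a = q b ↔ p a = p b := fun a b => Subtype.ext_iff
  let H : SimpleGraph (Set.range p) := SimpleGraph.fromRel fun a b =>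
    ∃ a' b', q a' = a ∧ q b' = b ∧ G.Adj a' b'
  have hHadj : ∀ a b, H.Adj a b → ∃ a' b', q a' = a ∧ q b' = b ∧ G.Adj a' b' := by
    intro a b hab
    rw [SimpleGraph.fromRel_adj] at hab
    obtain ⟨-, h | ⟨a', b', h1, h2, h3⟩⟩ := hab
    · exact h
    · exact ⟨b', a', h2, h1, h3.symm⟩
  have hadjH : ∀ a b, G.Adj a b → H.Adj (q a) (q b) := by
    intro a b hab
    rw [SimpleGraph.fromRel_adj]
    exact ⟨fun h => hloop a b hab ((hq a b).1 h), Or.inl ⟨a, b, rfl, rfl, hab⟩⟩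
  let φ : G →g H := ⟨q, fun {a b} h => hadjH a b h⟩
  refine ⟨H, ?_, ?_, ?_⟩
  · have hne : Nonempty (Set.range p) := hG.nonempty.map q
    refine SimpleGraph.Connected.mk ?_
    rintro ⟨_, a, rfl⟩ ⟨_, b, rfl⟩
    exact (hG.preconnected a b).map φ
  · rw [numColorings_eq_card]
    refine Finset.card_le_card_of_injOn (fun f a => f a) ?_ ?_
    · intro f hf
      simp only [Finset.coe_filter, Set.mem_ofPred_eq, mem_properColorings] at hf
      simp only [Finset.mem_coe, mem_properColorings]
      intro a b hab
      obtain ⟨a', b', rfl, rfl, h⟩ := hHadj a b hab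
      have := hf.1 a' b' h
      rwa [← hP f hf.2 a', ← hP f hf.2 b'] at this
    · intro f hf g hg h
      simp only [Finset.coe_filter, Set.mem_ofPred_eq] at hf hg
      funext v
      rw [← hP f hf.2, ← hP g hg.2]
      exact congrFun h (q v)
  · rintro k ⟨c⟩
    refine ⟨c.comp φ, fun a b hab => ?_⟩
    exact congrArg c ((hq a b).2 hab)

lemma natCard_range_le {V : Type} [Fintype V] (p : V → V) (M : Finset V) (hM : ∀ v, p v ∉ M) :
    Nat.card (Set.range p) + M.card ≤ Nat.card V := by
  classical
  have h : Nat.card (Set.range p) ≤ (Mᶜ).card := by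
    rw [Nat.card_coe_set_eq, ← Set.ncard_coe_finset]
    refine Set.ncard_le_ncard ?_ (Set.toFinite _)
    rintro _ ⟨v, rfl⟩
    simpa using hM v
  rw [Finset.card_compl] at h
  have := M.card_le_univ
  rw [Nat.card_eq_fintype_card (α := V)]
  omega

/-- A bound for all connected non-`k`-colourable graphs gains a factor `y` for every vertex that
is identified with another one. -/
lemma card_filter_le_of_identification {k x : ℕ} {C y : ℝ} (hC : 0 ≤ C) (hy : 1 ≤ y)
    (hbound : ∀ (W : Type) [Fintype W] (H : SimpleGraph W), H.Connected → ¬ H.Colorable k →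
      (numColorings H x : ℝ) ≤ C * y ^ Nat.card W)
    {V : Type} [Fintype V] {G : SimpleGraph V} (hG : G.Connected) (hcol : ¬ G.Colorable k)
    (p : V → V) (M : Finset V) (hM : ∀ v, p v ∉ M)
    (P : (V → Fin x) → Prop) [DecidablePred P] (hP : ∀ f, P f → ∀ v, f (p v) = f v) :
    (((properColorings G x).filter P).card : ℝ) ≤ C * y ^ Nat.card V / y ^ M.card := by
  classical
  obtain h | ⟨H, hH, hle, hc⟩ := exists_connected_identification hG p P hP
  · rw [Finset.filter_false_of_mem h]
    simp only [Finset.card_empty, Nat.cast_zero]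
    positivity
  · have hHc : ¬ H.Colorable k := fun h => hcol ⟨(hc k h).choose⟩
    calc (((properColorings G x).filter P).card : ℝ) ≤ numColorings H x := by exact_mod_cast hle
      _ ≤ C * y ^ Nat.card (Set.range p) := hbound _ H hH hHc
      _ ≤ C * y ^ Nat.card V / y ^ M.card := by
        rw [le_div_iff₀ (by positivity), mul_assoc, ← pow_add]
        exact mul_le_mul_of_nonneg_left (pow_le_pow_right₀ hy (natCard_range_le p M hM)) hC

/-- In a colouring of `G - v` that does not extend to `G`, the vertex `v` sees every colour. -/
lemma exists_adj_color_eq {V : Type} {G : SimpleGraph V} {k : ℕ} (hG : ¬ G.Colorable k) (v : V)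
    {T : Set V} (hT : ∀ u, u ≠ v → u ∈ T) (c : (G.induce T).Coloring (Fin k)) (i : Fin k) :
    ∃ u : T, G.Adj v u ∧ c u = i := by
  classical
  by_contra! h
  refine hG ⟨SimpleGraph.Coloring.mk
    (fun u => if hu : u = v then i else c ⟨u, hT u hu⟩) ?_⟩
  intro a b hab
  by_cases ha : a = v
  · have hb : b ≠ v := fun hb => hab.ne (ha.trans hb.symm)
    subst ha
    simpa [hb] using (h ⟨b, hT b hb⟩ hab).symm
  · by_cases hb : b = v
    · subst hb
      simpa [ha] using h ⟨a, hT a ha⟩ hab.symm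
    · simp only [ha, hb, dite_false]
      exact c.valid (v := ⟨a, hT a ha⟩) (w := ⟨b, hT b hb⟩) hab

lemma colorable_succ_of_induce_compl {V : Type} {G : SimpleGraph V} {k : ℕ} (v : V)
    (h : (G.induce {v}ᶜ).Colorable k) : G.Colorable (k + 1) := by
  classical
  by_contra hG
  obtain ⟨c⟩ := h
  let c' : (G.induce {v}ᶜ).Coloring (Fin (k + 1)) :=
    SimpleGraph.Coloring.mk (fun u => (c u).castSucc) fun {a b} hab h =>
      c.valid hab (Fin.castSucc_injective _ h)
  obtain ⟨u, -, hu⟩ := exists_adj_color_eq hG v (T := {v}ᶜ) (fun u hu => hu) c' (Fin.last k)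
  exact absurd hu (Fin.castSucc_lt_last _).ne

lemma numColorings_le_mul_induce_compl {V : Type} [Fintype V] [Nontrivial V] {G : SimpleGraph V}
    (hG : G.Connected) (y : ℕ) (v : V) :
    (numColorings G (y + 1) : ℝ) ≤ y * numColorings (G.induce {v}ᶜ) (y + 1) := by
  classical
  obtain ⟨u, hu⟩ := hG.preconnected.exists_adj_of_nontrivial v
  refine (numColorings_le_sum G (y + 1) v {⟨u, hu.ne'⟩} (by simpa using hu)).trans ?_
  rw [numColorings_eq_card]
  simp [mul_comm]

lemma natCard_compl_singleton {V : Type} [Fintype V] (v : V) :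
    Nat.card ({v}ᶜ : Set V) + 1 = Nat.card V := by
  classical
  have h := Set.ncard_add_ncard_compl {v}
  rw [Set.ncard_singleton] at h
  rw [Nat.card_coe_set_eq]
  omega

/-- A connected graph has at most as many colourings as a tree of the same order. -/
lemma numColorings_le_of_connected {y : ℕ} (hy : 0 < y) {V : Type} [Fintype V]
    {G : SimpleGraph V} (hG : G.Connected) :
    (numColorings G (y + 1) : ℝ) ≤ (y + 1) / y * (y : ℝ) ^ Nat.card V := by
  classical
  induction hn : Nat.card V using Nat.strong_induction_on generalizing V with
  | _ n ih =>
  subst hn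
  have hy' : (0 : ℝ) < y := by exact_mod_cast hy
  obtain hV | hV := subsingleton_or_nontrivial V
  · have := hG.nonempty
    have hcard : Nat.card V = 1 := Nat.card_unique
    have h : numColorings G (y + 1) ≤ y + 1 := by
      rw [numColorings_eq_card]
      refine (Finset.card_le_univ _).trans ?_
      rw [Fintype.card_fun, ← Nat.card_eq_fintype_card (α := V), hcard, Fintype.card_fin, pow_one]
    rw [hcard, pow_one, div_mul_cancel₀ _ hy'.ne']
    exact_mod_cast h
  · obtain ⟨v, hv⟩ := hG.exists_connected_induce_compl_singleton_of_finite_nontrivial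
    have hcard := natCard_compl_singleton v
    have := ih _ (by omega) hv rfl
    calc (numColorings G (y + 1) : ℝ)
        ≤ y * numColorings (G.induce {v}ᶜ) (y + 1) := numColorings_le_mul_induce_compl hG y v
      _ ≤ y * ((y + 1) / y * (y : ℝ) ^ Nat.card ({v}ᶜ : Set V)) := by gcongr
      _ = (y + 1) / y * (y : ℝ) ^ Nat.card V := by rw [← hcard, pow_succ]; ring

lemma apply_eq_iff_of_two_colorings {V : Type} {G : SimpleGraph V} (hG : G.Connected)
    (c d : G.Coloring (Fin 2)) (a b : V) : c a = c b ↔ d a = d b := by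
  have key : ∀ a b, G.Reachable a b → (c a = d a ↔ c b = d b) := by
    rintro a b ⟨w⟩
    induction w with
    | nil => rfl
    | cons h _ ih =>
      have h1 := c.valid h
      have h2 := d.valid h
      rw [← ih]
      omega
  have := key a b (hG.preconnected a b)
  omega

lemma nontrivial_of_not_colorable {V : Type} [Fintype V] {G : SimpleGraph V} {k : ℕ} (hk : 0 < k)
    (h : ¬ G.Colorable k) : Nontrivial V := by
  by_contra hV
  rw [not_nontrivial_iff_subsingleton] at hV
  exact h ⟨SimpleGraph.Coloring.mk (fun _ => ⟨0, hk⟩)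
    fun hab => absurd (Subsingleton.elim _ _) hab.ne⟩

lemma sum_ite_eq_card_filter {α : Type} (s : Finset α) (P : α → Prop) [DecidablePred P] :
    ∑ f ∈ s, (if P f then (1 : ℝ) else 0) = ((s.filter P).card : ℝ) := by
  simp

/-- A connected non-bipartite graph of order `m` has at most `y ^ m` colourings
with `y + 1` colours. -/
lemma numColorings_le_of_not_colorable_two {y : ℕ} (hy : 0 < y) {V : Type} [Fintype V]
    {G : SimpleGraph V} (hG : G.Connected) (hcol : ¬ G.Colorable 2) :
    (numColorings G (y + 1) : ℝ) ≤ (y : ℝ) ^ Nat.card V := by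
  classical
  induction hn : Nat.card V using Nat.strong_induction_on generalizing V with
  | _ n ih =>
  subst hn
  have hy' : (1 : ℝ) ≤ y := by exact_mod_cast hy
  have := nontrivial_of_not_colorable two_pos hcol
  obtain ⟨v, hv⟩ := hG.exists_connected_induce_compl_singleton_of_finite_nontrivial
  have hcard := natCard_compl_singleton v
  by_cases h2 : (G.induce {v}ᶜ).Colorable 2
  · obtain ⟨c⟩ := h2
    obtain ⟨u, hu, hcu⟩ := exists_adj_color_eq hcol v (T := {v}ᶜ) (fun u hu => hu) c 0
    obtain ⟨w, hw, hcw⟩ := exists_adj_color_eq hcol v (T := {v}ᶜ) (fun u hu => hu) c 1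
    have huw : u ≠ w := by
      rintro rfl
      exact absurd (hcu.symm.trans hcw) (by decide)
    have hsum := numColorings_le_sum G (y + 1) v {u, w} (by simp [hu, hw])
    have hpoint : ∀ f : ({v}ᶜ : Set V) → Fin (y + 1),
        ((y + 1 - (Finset.image f {u, w}).card : ℕ) : ℝ) ≤
          (y - 1) + if f u = f w then (1 : ℝ) else 0 := by
      intro f
      rw [Finset.image_insert, Finset.image_singleton]
      by_cases h : f u = f w
      · simp [h]
      · rw [Finset.card_pair h, Nat.cast_sub (by omega)]
        simp only [h, if_false]
        push_cast
        linarith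
    have hX : (((properColorings (G.induce {v}ᶜ) (y + 1)).filter fun f => f u = f w).card : ℝ) ≤
        (y : ℝ) ^ Nat.card ({v}ᶜ : Set V) / y := by
      obtain h | ⟨H, hH, hle, hc⟩ := exists_connected_identification (x := y + 1) hv
        (Function.update id w u) (fun f => f u = f w) (by
          intro f hf a
          by_cases ha : a = w
          · subst ha; simpa using hf
          · simp [ha])
      · rw [Finset.filter_false_of_mem h]
        simp only [Finset.card_empty, Nat.cast_zero]
        positivity
      · have hr : Nat.card (Set.range (Function.update id w u)) + _ ≤ _ :=
          natCard_range_le (Function.update id w u) {w} (by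
            intro a
            by_cases ha : a = w
            · subst ha; simpa using huw
            · simp [ha])
        rw [Finset.card_singleton] at hr
        have hH2 : ¬ H.Colorable 2 := by
          intro h
          obtain ⟨d, hd⟩ := hc 2 h
          have : d u = d w := hd u w (by simp [huw])
          have := (apply_eq_iff_of_two_colorings hv c d u w).2 this
          rw [hcu, hcw] at this
          exact absurd this (by decide)
        have hHb := ih _ (by omega) hH hH2 rfl
        rw [le_div_iff₀ (by positivity)]
        calc _ ≤ (numColorings H (y + 1) : ℝ) * y := by gcongr
          _ ≤ (y : ℝ) ^ Nat.card (Set.range (Function.update id w u)) * y := by gcongr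
          _ = (y : ℝ) ^ (Nat.card (Set.range (Function.update id w u)) + 1) := by rw [pow_succ]
          _ ≤ _ := pow_le_pow_right₀ hy' hr
    have hT := numColorings_le_of_connected hy hv
    have hsum' := hsum.trans (Finset.sum_le_sum fun f _ => hpoint f)
    rw [Finset.sum_add_distrib, sum_ite_eq_card_filter, Finset.sum_const, nsmul_eq_mul,
      ← numColorings_eq_card] at hsum'
    set Y := (y : ℝ) ^ Nat.card ({v}ᶜ : Set V) with hY
    have hfac : (0 : ℝ) ≤ y - 1 := by linarith
    calc (numColorings G (y + 1) : ℝ)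
        ≤ ((y + 1) / y * Y) * (y - 1) + Y / y := hsum'.trans (by gcongr)
      _ = Y * y := by field_simp; ring
      _ = _ := by rw [hY, ← pow_succ, hcard]
  · calc (numColorings G (y + 1) : ℝ)
        ≤ y * numColorings (G.induce {v}ᶜ) (y + 1) := numColorings_le_mul_induce_compl hG y v
      _ ≤ y * (y : ℝ) ^ Nat.card ({v}ᶜ : Set V) := by
        gcongr
        exact ih _ (by omega) hv h2 rfl
      _ = (y : ℝ) ^ Nat.card V := by rw [← hcard, pow_succ]; ring

open Classical in
lemma card_filter_eq_le {k x : ℕ} {C y : ℝ} (hC : 0 ≤ C) (hy : 1 ≤ y)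
    (hbound : ∀ (W : Type) [Fintype W] (H : SimpleGraph W), H.Connected → ¬ H.Colorable k →
      (numColorings H x : ℝ) ≤ C * y ^ Nat.card W)
    {V : Type} [Fintype V] {G : SimpleGraph V} (hG : G.Connected) (hcol : ¬ G.Colorable k)
    {a b : V} (hab : a ≠ b) :
    (((properColorings G x).filter fun f => f a = f b).card : ℝ) ≤ C * y ^ Nat.card V / y := by
  have h := card_filter_le_of_identification hC hy hbound hG hcol (Function.update id b a) {b}
    (by intro v; simp only [Function.update_apply]; aesop) (fun f => f a = f b)
    (by intro f hf v; simp only [Function.update_apply]; aesop)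
  simpa using h

/-- A bound for the number of `(y + 1)`-colourings of a connected graph that is not
`3`-colourable. -/
lemma numColorings_le_of_not_colorable_three {y : ℕ} (hy : 2 ≤ y) {V : Type} [Fintype V]
    {G : SimpleGraph V} (hG : G.Connected) (hcol : ¬ G.Colorable 3) :
    (numColorings G (y + 1) : ℝ) ≤ (y ^ 2 - 2 * y + 3) / y ^ 2 * (y : ℝ) ^ Nat.card V := by
  classical
  induction hn : Nat.card V using Nat.strong_induction_on generalizing V with
  | _ n ih =>
  subst hn
  have hy' : (2 : ℝ) ≤ y := by exact_mod_cast hy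
  have := nontrivial_of_not_colorable three_pos hcol
  obtain ⟨v, hv⟩ := hG.exists_connected_induce_compl_singleton_of_finite_nontrivial
  have hcard := natCard_compl_singleton v
  by_cases h3 : (G.induce {v}ᶜ).Colorable 3
  · have h2 : ¬ (G.induce {v}ᶜ).Colorable 2 := fun h => hcol (colorable_succ_of_induce_compl v h)
    obtain ⟨c⟩ := h3
    choose u hu hcu using exists_adj_color_eq hcol v (T := {v}ᶜ) (fun u hu => hu) c
    have hinj : ∀ i j, i ≠ j → u i ≠ u j := by
      intro i j hij h
      exact hij (by rw [← hcu i, ← hcu j, h])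
    have hsum := numColorings_le_sum G (y + 1) v {u 0, u 1, u 2} (by simp [hu])
    have hpoint : ∀ f : ({v}ᶜ : Set V) → Fin (y + 1),
        ((y + 1 - (Finset.image f {u 0, u 1, u 2}).card : ℕ) : ℝ) ≤
          (y - 2) + (((if f (u 0) = f (u 1) then (1 : ℝ) else 0) +
            if f (u 0) = f (u 2) then (1 : ℝ) else 0) +
            if f (u 1) = f (u 2) then (1 : ℝ) else 0) := by
      intro f
      rw [Finset.image_insert, Finset.image_insert, Finset.image_singleton]
      obtain ⟨z, rfl⟩ := Nat.exists_eq_add_of_le' hy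
      by_cases h01 : f (u 0) = f (u 1) <;> by_cases h02 : f (u 0) = f (u 2) <;>
        by_cases h12 : f (u 1) = f (u 2) <;> simp_all <;> linarith
    have hX : ∀ i j, i ≠ j →
        (((properColorings (G.induce {v}ᶜ) (y + 1)).filter
          fun f => f (u i) = f (u j)).card : ℝ) ≤ 1 * (y : ℝ) ^ Nat.card ({v}ᶜ : Set V) / y := by
      intro i j hij
      refine card_filter_eq_le zero_le_one (by linarith) ?_ hv h2 (hinj i j hij)
      intro W _ H hH hH2
      rw [one_mul]
      exact numColorings_le_of_not_colorable_two (by omega) hH hH2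
    have hX01 := hX 0 1 (by decide)
    have hX02 := hX 0 2 (by decide)
    have hX12 := hX 1 2 (by decide)
    have hT := numColorings_le_of_not_colorable_two (y := y) (by omega) hv h2
    have hsum' := hsum.trans (Finset.sum_le_sum fun f _ => hpoint f)
    rw [Finset.sum_add_distrib, Finset.sum_add_distrib, Finset.sum_add_distrib,
      sum_ite_eq_card_filter, sum_ite_eq_card_filter, sum_ite_eq_card_filter, Finset.sum_const,
      nsmul_eq_mul, ← numColorings_eq_card] at hsum'
    set Y := (y : ℝ) ^ Nat.card ({v}ᶜ : Set V) with hY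
    have hfac : (0 : ℝ) ≤ y - 2 := by linarith
    calc (numColorings G (y + 1) : ℝ)
        ≤ Y * (y - 2) + (1 * Y / y + 1 * Y / y + 1 * Y / y) := hsum'.trans (by gcongr)
      _ = (y ^ 2 - 2 * y + 3) / y ^ 2 * (Y * y) := by field_simp; ring
      _ = _ := by rw [hY, ← pow_succ, hcard]
  · calc (numColorings G (y + 1) : ℝ)
        ≤ y * numColorings (G.induce {v}ᶜ) (y + 1) := numColorings_le_mul_induce_compl hG y v
      _ ≤ y * ((y ^ 2 - 2 * y + 3) / y ^ 2 * (y : ℝ) ^ Nat.card ({v}ᶜ : Set V)) := by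
        gcongr
        exact ih _ (by omega) hv h3 rfl
      _ = (y ^ 2 - 2 * y + 3) / y ^ 2 * (y : ℝ) ^ Nat.card V := by rw [← hcard, pow_succ]; ring

/-- A function of the number of colours seen on four vertices is bounded by a combination of
indicators of coincidences among the colours of these vertices. -/
lemma apply_card_image_le {α : Type} [DecidableEq α] {g : ℕ → ℝ} {p q r s : ℝ}
    (h4 : g 4 ≤ p) (h3 : g 3 ≤ p + q) (h22 : g 2 ≤ p + 2 * q + r)
    (h31 : g 2 ≤ p + 3 * q + s) (h1 : g 1 ≤ p + 6 * q + 3 * r + 4 * s) (a b c d : α) :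
    g ({a, b, c, d} : Finset α).card ≤ p +
      (q * (if a = b then 1 else 0) + q * (if a = c then 1 else 0) +
        q * (if a = d then 1 else 0) + q * (if b = c then 1 else 0) +
        q * (if b = d then 1 else 0) + q * (if c = d then 1 else 0) +
        r * (if a = b ∧ c = d then 1 else 0) + r * (if a = c ∧ b = d then 1 else 0) +
        r * (if a = d ∧ b = c then 1 else 0) + s * (if a = b ∧ a = c then 1 else 0) +
        s * (if a = b ∧ a = d then 1 else 0) + s * (if a = c ∧ a = d then 1 else 0) +
        s * (if b = c ∧ b = d then 1 else 0)) := by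
  by_cases hab : a = b
  · subst hab
    by_cases hac : a = c
    · subst hac
      by_cases had : a = d
      · subst had; simp; linarith
      · simp [had]; linarith
    · by_cases had : a = d
      · subst had; simp [hac, Ne.symm hac]; linarith
      · by_cases hcd : c = d
        · subst hcd; simp [hac]; linarith
        · simp [hac, had, hcd]; linarith
  · by_cases hac : a = c
    · subst hac
      by_cases had : a = d
      · subst had; simp [hab, Ne.symm hab]; linarith
      · by_cases hbd : b = d
        · subst hbd; simp [hab, Ne.symm hab]; linarith
        · simp [hab, had, hbd, Ne.symm hab]; linarith
    · by_cases hbc : b = c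
      · subst hbc
        by_cases had : a = d
        · subst had; simp [hab, Ne.symm hab]; linarith
        · by_cases hbd : b = d
          · subst hbd; simp [hab]; linarith
          · simp [hab, had, hbd]; linarith
      · by_cases had : a = d
        · subst had; simp [hab, hac, hbc, Ne.symm hab, Ne.symm hac]; linarith
        · by_cases hbd : b = d
          · subst hbd; simp [hab, hac, hbc, Ne.symm hbc]; linarith
          · by_cases hcd : c = d
            · subst hcd; simp [hab, hac, hbc]; linarith
            · simp [hab, hac, had, hbc, hbd, hcd]; linarith

open Classical in
lemma sum_apply_card_image_le {k x : ℕ} {C y : ℝ} (hC : 0 ≤ C) (hy : 1 ≤ y)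
    (hbound : ∀ (W : Type) [Fintype W] (H : SimpleGraph W), H.Connected → ¬ H.Colorable k →
      (numColorings H x : ℝ) ≤ C * y ^ Nat.card W)
    {V : Type} [Fintype V] {G : SimpleGraph V} (hG : G.Connected) (hcol : ¬ G.Colorable k)
    {g : ℕ → ℝ} {p q r s : ℝ} (hp : 0 ≤ p) (hq : 0 ≤ q) (hr : 0 ≤ r) (hs : 0 ≤ s)
    (h4 : g 4 ≤ p) (h3 : g 3 ≤ p + q) (h22 : g 2 ≤ p + 2 * q + r)
    (h31 : g 2 ≤ p + 3 * q + s) (h1 : g 1 ≤ p + 6 * q + 3 * r + 4 * s)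
    {N : Finset V} (hN : N.card = 4) :
    ∑ f ∈ properColorings G x, g (N.image f).card ≤
      (p + 6 * q / y + (3 * r + 4 * s) / y ^ 2) * (C * y ^ Nat.card V) := by
  obtain ⟨a, b, c, d, hab, hac, had, hbc, hbd, hcd, rfl⟩ := Finset.card_eq_four.1 hN
  have hpair : ∀ a b : V, a ≠ b → (((properColorings G x).filter fun f => f a = f b).card : ℝ) ≤
      C * y ^ Nat.card V / y := fun a b h => card_filter_eq_le hC hy hbound hG hcol h
  have hpairs : ∀ a b c d : V, a ≠ b → a ≠ d → b ≠ c → b ≠ d → c ≠ d →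
      (((properColorings G x).filter fun f => f a = f b ∧ f c = f d).card : ℝ) ≤
      C * y ^ Nat.card V / y ^ 2 := by
    intro a b c d hab had hbc hbd hcd
    have h := card_filter_le_of_identification hC hy hbound hG hcol
      (fun v => if v = b then a else if v = d then c else v) {b, d}
      (by
        intro v
        have := hbc.symm
        split_ifs <;> simp_all)
      (fun f => f a = f b ∧ f c = f d)
      (by
        rintro f ⟨h1, h2⟩ v
        split_ifs <;> simp_all)
    rwa [Finset.card_pair hbd] at h
  have htriple : ∀ a b c : V, a ≠ b → a ≠ c → b ≠ c →
      (((properColorings G x).filter fun f => f a = f b ∧ f a = f c).card : ℝ) ≤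
      C * y ^ Nat.card V / y ^ 2 := fun a b c hab hac hbc =>
    hpairs a b a c hab hac hab.symm hbc hac
  refine (Finset.sum_le_sum (g := fun f => p +
      (q * (if f a = f b then 1 else 0) + q * (if f a = f c then 1 else 0) +
        q * (if f a = f d then 1 else 0) + q * (if f b = f c then 1 else 0) +
        q * (if f b = f d then 1 else 0) + q * (if f c = f d then 1 else 0) +
        r * (if f a = f b ∧ f c = f d then 1 else 0) +
        r * (if f a = f c ∧ f b = f d then 1 else 0) +
        r * (if f a = f d ∧ f b = f c then 1 else 0) +
        s * (if f a = f b ∧ f a = f c then 1 else 0) +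
        s * (if f a = f b ∧ f a = f d then 1 else 0) +
        s * (if f a = f c ∧ f a = f d then 1 else 0) +
        s * (if f b = f c ∧ f b = f d then 1 else 0))) fun f _ => ?_).trans ?_
  · simp only [Finset.image_insert, Finset.image_singleton]
    convert apply_card_image_le h4 h3 h22 h31 h1 (f a) (f b) (f c) (f d)
  · simp only [Finset.sum_add_distrib, ← Finset.mul_sum, sum_ite_eq_card_filter, Finset.sum_const,
      nsmul_eq_mul, ← numColorings_eq_card]
    have hT := hbound V G hG hcol
    calc _ ≤ (C * y ^ Nat.card V) * p + (q * (C * y ^ Nat.card V / y) +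
          q * (C * y ^ Nat.card V / y) + q * (C * y ^ Nat.card V / y) +
          q * (C * y ^ Nat.card V / y) + q * (C * y ^ Nat.card V / y) +
          q * (C * y ^ Nat.card V / y) + r * (C * y ^ Nat.card V / y ^ 2) +
          r * (C * y ^ Nat.card V / y ^ 2) + r * (C * y ^ Nat.card V / y ^ 2) +
          s * (C * y ^ Nat.card V / y ^ 2) + s * (C * y ^ Nat.card V / y ^ 2) +
          s * (C * y ^ Nat.card V / y ^ 2) + s * (C * y ^ Nat.card V / y ^ 2)) := by
          gcongr
          · exact hpair a b hab
          · exact hpair a c hac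
          · exact hpair a d had
          · exact hpair b c hbc
          · exact hpair b d hbd
          · exact hpair c d hcd
          · exact hpairs a b c d hab had hbc hbd hcd
          · exact hpairs a c b d hac had hbc.symm hcd hbd
          · exact hpairs a d b c had hac hbd.symm hcd.symm hbc
          · exact htriple a b c hab hac hbc
          · exact htriple a b d hab had hbd
          · exact htriple a c d hac had hcd
          · exact htriple b c d hbc hbd hcd
      _ = _ := by ring

open Classical in
/-- The fourth moment of the number of colours available to a new vertex with four prescribed
neighbours. -/
lemma sum_pow_four_le {y : ℕ} (hy : 4 ≤ y) {V : Type} [Fintype V] {G : SimpleGraph V}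
    (hG : G.Connected) (hcol : ¬ G.Colorable 3) {N : Finset V} (hN : N.card = 4) :
    ∑ f ∈ properColorings G (y + 1), ((y + 1 - (N.image f).card : ℕ) : ℝ) ^ 4 ≤
      (y + 1) * (y - 1) * (y - 2) * (y - 3) * (y : ℝ) ^ Nat.card V := by
  have hy' : (4 : ℝ) ≤ y := by exact_mod_cast hy
  have hC : (0 : ℝ) ≤ (y ^ 2 - 2 * y + 3) / y ^ 2 :=
    div_nonneg (by nlinarith) (by positivity)
  have main := fun p q r s : ℝ => sum_apply_card_image_le (x := y + 1) (k := 3) (y := y) hC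
    (by linarith) (fun W _ H hH hH3 => numColorings_le_of_not_colorable_three (by omega) hH hH3)
    hG hcol (g := fun i => ((y + 1 - i : ℕ) : ℝ) ^ 4) (p := p) (q := q) (r := r) (s := s) (N := N)
  obtain rfl | hy5 := hy.eq_or_lt
  · refine (main 1 15 50 35 (by norm_num) (by norm_num) (by norm_num) (by norm_num) (by norm_num)
      (by norm_num) (by norm_num) (by norm_num) (by norm_num) hN).trans ?_
    rw [← mul_assoc]
    refine mul_le_mul_of_nonneg_right ?_ (by positivity)
    norm_num
  · obtain ⟨t, rfl⟩ := Nat.exists_eq_add_of_le' hy5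
    have hD : (0 : ℝ) ≤ (t + 4) ^ 4 - (t + 3) ^ 4 := by
      have : (0 : ℝ) ≤ 4 * t ^ 3 + 42 * t ^ 2 + 148 * t + 175 := by positivity
      linarith
    have e4 : t + (4 + 1) + 1 - 4 = t + 2 := by omega
    have e3 : t + (4 + 1) + 1 - 3 = t + 3 := by omega
    have e2 : t + (4 + 1) + 1 - 2 = t + 4 := by omega
    have e1 : t + (4 + 1) + 1 - 1 = t + 5 := by omega
    have ht : (0 : ℝ) ≤ t := t.cast_nonneg
    refine (main ((t + 3) ^ 4) 0 ((t + 4) ^ 4 - (t + 3) ^ 4) ((t + 4) ^ 4 - (t + 3) ^ 4)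
      (by positivity) le_rfl hD hD ?_ ?_ ?_ ?_ ?_ hN).trans ?_
    · simp only [e4]; push_cast; gcongr; norm_num
    · simp only [e3]; push_cast; linarith
    · simp only [e2]; push_cast; linarith
    · simp only [e2]; push_cast; linarith
    · simp only [e1]; push_cast
      nlinarith [pow_nonneg ht 2, pow_nonneg ht 3]
    · rw [← mul_assoc]
      refine mul_le_mul_of_nonneg_right ?_ (by positivity)
      push_cast
      rw [mul_div_assoc', div_le_iff₀ (by positivity), mul_zero, zero_div, add_zero,
        add_div' _ _ _ (by positivity), div_mul_eq_mul_div, div_le_iff₀ (by positivity), ← sub_nonneg]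
      ring_nf
      positivity

lemma mul_le_sum_pow_four (a b c d : ℝ) :
    a * (b * (c * d)) ≤ (a ^ 4 + b ^ 4 + c ^ 4 + d ^ 4) / 4 := by
  nlinarith [sq_nonneg (a * b - c * d), sq_nonneg (a ^ 2 - b ^ 2), sq_nonneg (c ^ 2 - d ^ 2)]

/-- If deleting a vertex makes `G` `k`-colourable, then in `G` that vertex has `k` neighbours. -/
lemma exists_neighbors_of_colorable_induce {V : Type} {G : SimpleGraph V} {k : ℕ}
    (hG : ¬ G.Colorable k) (v : V) (h : (G.induce {u : V | u ≠ v}).Colorable k) :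
    ∃ N : Finset V, N.card = k ∧ ∀ u ∈ N, G.Adj v u := by
  classical
  obtain ⟨c⟩ := h
  choose u hu hcu using exists_adj_color_eq hG v (T := {u : V | u ≠ v}) (fun u hu => hu) c
  refine ⟨Finset.univ.image fun i => (u i : V), ?_, by simpa using hu⟩
  rw [Finset.card_image_of_injective, Finset.card_univ, Fintype.card_fin]
  intro i j hij
  rw [← hcu i, ← hcu j, Subtype.ext hij]

/-- If `G` is a `5`-critical graph on `n` vertices and `S` is an independent set of size `4`
such that `G - S` is connected and has chromatic number `4`, then for every integer `y ≥ 4`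
we have `Q_G(y) ≤ (y+1)·y^(n-4)·(y-1)·(y-2)·(y-3)`. -/
theorem five_critical_indep_bound {V : Type} [Fintype V] (G : SimpleGraph V)
    (hcrit : FiveCritical G) (S : Finset V) (hcard : S.card = 4)
    (hindep : ∀ a ∈ S, ∀ b ∈ S, ¬ G.Adj a b)
    (hconn : (G.induce (↑S : Set V)ᶜ).Connected)
    (hchrom : (G.induce (↑S : Set V)ᶜ).chromaticNumber = 4)
    (y : ℕ) (hy : 4 ≤ y) :
    numColorings G (y + 1) ≤
      (y + 1) * y ^ (Fintype.card V - 4) * (y - 1) * (y - 2) * (y - 3) := by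
  classical
  have hG : ¬ G.Colorable 4 := by
    rw [← SimpleGraph.chromaticNumber_le_iff_colorable, hcrit.1]
    decide
  have hH : ¬ (G.induce (↑S : Set V)ᶜ).Colorable 3 := by
    rw [← SimpleGraph.chromaticNumber_le_iff_colorable, hchrom]
    decide
  have hN : ∀ s, ∃ N : Finset ((↑S : Set V)ᶜ : Set V), s ∈ S →
      N.card = 4 ∧ ∀ u ∈ N, G.Adj s u := by
    intro s
    by_cases hs : s ∈ S
    · have h4 : (G.induce {u : V | u ≠ s}).Colorable 4 := by
        rw [← SimpleGraph.chromaticNumber_le_iff_colorable, hcrit.2 s]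
        exact le_rfl
      obtain ⟨N, hN4, hN⟩ := exists_neighbors_of_colorable_induce hG s h4
      refine ⟨N.subtype _, fun _ => ⟨?_, fun u hu => hN u (by simpa using hu)⟩⟩
      rw [Finset.card_subtype, Finset.filter_true_of_mem, hN4]
      intro u hu huS
      exact hindep s hs u huS (hN u hu)
    · exact ⟨∅, fun h => absurd h hs⟩
  choose N hN using hN
  have hcount := numColorings_le_sum_prod G (y + 1) S (↑S : Set V)ᶜ (by simp) N
    fun s hs => (hN s hs).2
  have hVcard : Nat.card ((↑S : Set V)ᶜ : Set V) = Fintype.card V - 4 := by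
    rw [Nat.card_coe_set_eq, ← Finset.coe_compl, Set.ncard_coe_finset, Finset.card_compl, hcard]
  have hmoment : ∀ s ∈ S, _ := fun s hs => sum_pow_four_le hy hconn hH (hN s hs).1
  rw [hVcard] at hmoment
  obtain ⟨a, b, c, d, hab, hac, had, hbc, hbd, hcd, rfl⟩ := Finset.card_eq_four.1 hcard
  have ha := hmoment a (by simp)
  have hb := hmoment b (by simp)
  have hc := hmoment c (by simp)
  have hd := hmoment d (by simp)
  have hreal : (numColorings G (y + 1) : ℝ) ≤
      (y + 1) * (y - 1) * (y - 2) * (y - 3) * (y : ℝ) ^ (Fintype.card V - 4) := by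
    refine (Nat.cast_le.2 hcount).trans ?_
    rw [Nat.cast_sum]
    simp only [Nat.cast_prod]
    refine (Finset.sum_le_sum (g := fun f => (((y + 1 - ((N a).image f).card : ℕ) : ℝ) ^ 4 +
        ((y + 1 - ((N b).image f).card : ℕ) : ℝ) ^ 4 +
        ((y + 1 - ((N c).image f).card : ℕ) : ℝ) ^ 4 +
        ((y + 1 - ((N d).image f).card : ℕ) : ℝ) ^ 4) / 4) fun f _ => ?_).trans ?_
    · rw [Finset.prod_insert (by simp [hab, hac, had]), Finset.prod_insert (by simp [hbc, hbd]),
        Finset.prod_pair hcd]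
      exact mul_le_sum_pow_four _ _ _ _
    · rw [← Finset.sum_div, Finset.sum_add_distrib, Finset.sum_add_distrib,
        Finset.sum_add_distrib]
      linarith
  obtain ⟨z, rfl⟩ := Nat.exists_eq_add_of_le' hy
  have e1 : z + 4 - 1 = z + 3 := rfl
  have e2 : z + 4 - 2 = z + 2 := rfl
  have e3 : z + 4 - 3 = z + 1 := rfl
  rw [e1, e2, e3]
  rw [← Nat.cast_le (α := ℝ)]
  refine hreal.trans (le_of_eq ?_)
  push_cast
  ring
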